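/- The Barenblatt function 𝒰 is a solution in the sense of distributions of ∂_t u = ∂²_{xx}(u^m) with initial condition the Dirac measure δ₀: for every φ ∈ C_c^∞(ℝ) and every t > 0, ∫_ℝ φ(x) 𝒰(t,x) dx = φ(0) + ∫₀ᵗ ∫_ℝ 𝒰(s,x)^m φ''(x) dx ds. -/

import Mathlib

open MeasureTheory Real Set

/-- The constant k̃ = (1-m)/(2(m+1)m). -/
noncomputable def ktilde (m : ℝ) : ℝ := (1 - m) / (2 * (m + 1) * m)

/-- The constant I = ∫_{-π/2}^{π/2} (cos x)^{2m/(1-m)} dx. -/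
noncomputable def Iconst (m : ℝ) : ℝ := ∫ x in (-(π/2))..(π/2), Real.cos x ^ (2*m/(1-m))

/-- The constant D = (I/√k̃)^{2(1-m)/(m+1)}. -/
noncomputable def Dconst (m : ℝ) : ℝ := (Iconst m / Real.sqrt (ktilde m)) ^ (2*(1-m)/(m+1))

/-- The Barenblatt function 𝒰(t,x) = t^{-α}(D + k̃ x² t^{-2α})^{-1/(1-m)}, α = 1/(m+1). -/
noncomputable def barenblatt (m t x : ℝ) : ℝ :=
  t ^ (-(1/(m+1))) * (Dconst m + ktilde m * x^2 * t ^ (-(2*(1/(m+1))))) ^ (-(1/(1-m)))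

/-- The Barenblatt profile with general parameters, `y ↦ (d + k y²)^(-p)`. -/
noncomputable def barenblattProfile (d k p y : ℝ) : ℝ := (d + k * y ^ 2) ^ (-p)

section Profile

variable {d k p : ℝ}

lemma barenblattProfile_base_pos (hd : 0 < d) (hk : 0 < k) (y : ℝ) : 0 < d + k * y ^ 2 := by
  positivity

lemma barenblattProfile_pos (hd : 0 < d) (hk : 0 < k) (y : ℝ) : 0 < barenblattProfile d k p y :=
  rpow_pos_of_pos (barenblattProfile_base_pos hd hk y) _

lemma continuous_barenblattProfile (hd : 0 < d) (hk : 0 < k) :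
    Continuous (barenblattProfile d k p) :=
  Continuous.rpow_const (by fun_prop) fun y => Or.inl (barenblattProfile_base_pos hd hk y).ne'

lemma barenblattProfile_le (hd : 0 < d) (hk : 0 < k) (hp : 0 ≤ p) (y : ℝ) :
    barenblattProfile d k p y ≤ d ^ (-p) :=
  rpow_le_rpow_of_nonpos hd (by nlinarith [sq_nonneg y]) (by linarith)

lemma hasDerivAt_barenblattProfile (hd : 0 < d) (hk : 0 < k) (y : ℝ) :
    HasDerivAt (barenblattProfile d k p)
      (-(2 * k * p) * (y * barenblattProfile d k (p + 1) y)) y := by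
  have h : HasDerivAt (fun y : ℝ => d + k * y ^ 2) (k * (2 * y)) y := by
    simpa using ((hasDerivAt_pow 2 y).const_mul k).const_add d
  refine (h.rpow_const (p := -p) (Or.inl (barenblattProfile_base_pos hd hk y).ne')).congr_deriv ?_
  rw [barenblattProfile, show -p - 1 = -(p + 1) by ring]
  ring

/-- After the substitution `y = √(d/k) tan θ` the profile becomes a power of the cosine. -/
lemma barenblattProfile_comp_tan (hd : 0 < d) (hk : 0 < k) {θ : ℝ}
    (hθ : θ ∈ Ioo (-(π / 2)) (π / 2)) :
    |√(d / k) * (1 / cos θ ^ 2)| • barenblattProfile d k p (√(d / k) * tan θ)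
      = √(d / k) * d ^ (-p) * cos θ ^ (2 * p - 2) := by
  have hc : 0 < cos θ := cos_pos_of_mem_Ioo hθ
  have h1 : d + k * (√(d / k) * tan θ) ^ 2 = d * cos θ ^ (-2 : ℝ) := by
    rw [mul_pow, sq_sqrt (by positivity), tan_eq_sin_div_cos, rpow_neg hc.le, rpow_two]
    have := sin_sq_add_cos_sq θ
    field_simp
    linarith
  rw [barenblattProfile, h1, abs_of_nonneg (by positivity), mul_rpow hd.le (by positivity),
    ← rpow_mul hc.le, show 2 * p - 2 = (-2) * (-p) + (-2) by ring, rpow_add hc,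
    rpow_neg hc.le 2, rpow_two, smul_eq_mul]
  ring

lemma image_const_mul_tan {c : ℝ} (hc : c ≠ 0) :
    (fun θ => c * tan θ) '' Ioo (-(π / 2)) (π / 2) = univ := by
  refine eq_univ_of_forall fun y => ⟨arctan (y / c), arctan_mem_Ioo _, ?_⟩
  simp only [tan_arctan]
  field_simp

lemma hasDerivWithinAt_const_mul_tan (c : ℝ) {θ : ℝ} (hθ : θ ∈ Ioo (-(π / 2)) (π / 2)) :
    HasDerivWithinAt (fun θ => c * tan θ) (c * (1 / cos θ ^ 2)) (Ioo (-(π / 2)) (π / 2)) θ :=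
  ((hasDerivAt_tan (cos_pos_of_mem_Ioo hθ).ne').const_mul c).hasDerivWithinAt

lemma injOn_const_mul_tan {c : ℝ} (hc : c ≠ 0) :
    InjOn (fun θ => c * tan θ) (Ioo (-(π / 2)) (π / 2)) :=
  fun _ hx _ hy h => injOn_tan hx hy (mul_left_cancel₀ hc h)

lemma integrable_barenblattProfile (hd : 0 < d) (hk : 0 < k) (hp : 1 ≤ p) :
    Integrable (barenblattProfile d k p) := by
  have hc : √(d / k) ≠ 0 := by positivity
  rw [← integrableOn_univ, ← image_const_mul_tan hc,
    integrableOn_image_iff_integrableOn_abs_deriv_smul measurableSet_Ioo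
      (fun θ hθ => hasDerivWithinAt_const_mul_tan _ hθ) (injOn_const_mul_tan hc),
    integrableOn_congr_fun (fun θ hθ => barenblattProfile_comp_tan hd hk hθ) measurableSet_Ioo]
  refine IntegrableOn.mono_set ?_ Ioo_subset_Icc_self
  refine Continuous.integrableOn_Icc ?_
  exact continuous_const.mul (continuous_cos.rpow_const fun _ => Or.inr (by linarith))

lemma integral_barenblattProfile (hd : 0 < d) (hk : 0 < k) :
    ∫ y, barenblattProfile d k p y
      = √(d / k) * d ^ (-p) * ∫ θ in (-(π / 2))..(π / 2), cos θ ^ (2 * p - 2) := by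
  have hc : √(d / k) ≠ 0 := by positivity
  rw [← setIntegral_univ, ← image_const_mul_tan hc,
    integral_image_eq_integral_abs_deriv_smul measurableSet_Ioo
      (fun θ hθ => hasDerivWithinAt_const_mul_tan _ hθ) (injOn_const_mul_tan hc),
    setIntegral_congr_fun measurableSet_Ioo
      (fun θ hθ => barenblattProfile_comp_tan hd hk hθ),
    integral_const_mul, intervalIntegral.integral_of_le (by linarith [pi_pos]),
    integral_Ioc_eq_integral_Ioo]

end Profile

section Dilation

variable {φ f : ℝ → ℝ}

lemma HasCompactSupport.exists_norm_mul_le (hφ : Continuous φ) (hs : HasCompactSupport φ) :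
    ∃ C, ∀ x, ‖x * φ x‖ ≤ C :=
  (continuous_id.mul hφ).bounded_above_of_compact_support hs.mul_left

lemma continuous_integral_dilation_mul (hφ : Continuous φ) (hs : HasCompactSupport φ)
    (hf : Integrable f) : Continuous fun r : ℝ => ∫ y, φ (r * y) * f y := by
  obtain ⟨C, hC⟩ := hφ.bounded_above_of_compact_support hs
  refine continuous_of_dominated (bound := fun y => C * ‖f y‖) (fun r => ?_) (fun r => ?_)
    (hf.norm.const_mul C) ?_
  · exact Continuous.aestronglyMeasurable (by fun_prop) |>.mul hf.aestronglyMeasurable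
  · refine .of_forall fun y => ?_
    rw [norm_mul]
    exact mul_le_mul_of_nonneg_right (hC _) (norm_nonneg _)
  · exact .of_forall fun y => by fun_prop

lemma hasDerivAt_integral_dilation_mul (hφ : ContDiff ℝ 1 φ) (hs : HasCompactSupport φ)
    (hf : Integrable f) {r : ℝ} (hr : 0 < r) :
    HasDerivAt (fun r : ℝ => ∫ y, φ (r * y) * f y) (∫ y, deriv φ (r * y) * y * f y) r := by
  have hφ' : Continuous (deriv φ) := hφ.continuous_deriv le_rfl
  obtain ⟨B, hB⟩ := hφ.continuous.bounded_above_of_compact_support hs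
  obtain ⟨C, hC⟩ := hs.deriv.exists_norm_mul_le hφ'
  have hm (g : ℝ → ℝ) (hg : Continuous g) : AEStronglyMeasurable fun y => g y * f y :=
    hg.aestronglyMeasurable.mul hf.aestronglyMeasurable
  refine (hasDerivAt_integral_of_dominated_loc_of_deriv_le (s := Ioi (r / 2))
    (F' := fun s y => deriv φ (s * y) * y * f y)
    (bound := fun y => C / (r / 2) * ‖f y‖) (Ioi_mem_nhds (by linarith))
    (.of_forall fun s => hm _ (hφ.continuous.comp (continuous_const.mul continuous_id)))
    ?_ (hm (fun y => deriv φ (r * y) * y) (by fun_prop)) ?_ (hf.norm.const_mul _) ?_).2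
  · refine (hf.norm.const_mul B).mono'
      (hm _ (hφ.continuous.comp (continuous_const.mul continuous_id))) (.of_forall fun y => ?_)
    rw [norm_mul]
    exact mul_le_mul_of_nonneg_right (hB _) (norm_nonneg _)
  · refine .of_forall fun y s (hs : r / 2 < s) => ?_
    rw [norm_mul]
    refine mul_le_mul_of_nonneg_right ?_ (norm_nonneg _)
    have h := hC (s * y)
    rw [le_div_iff₀ (by linarith)]
    refine le_trans ?_ h
    rw [show s * y * deriv φ (s * y) = (deriv φ (s * y) * y) * s by ring, norm_mul _ s,
      norm_of_nonneg (show 0 ≤ s by linarith)]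
    exact mul_le_mul_of_nonneg_left hs.le (norm_nonneg _)
  · refine .of_forall fun y s _ => ?_
    have h := ((hφ.differentiable one_ne_zero (s * y)).hasDerivAt).comp s
      ((hasDerivAt_id s).mul_const y)
    simpa using h.mul_const (f y)

lemma integral_eq_mul_integral_dilation (g : ℝ → ℝ) {r : ℝ} (hr : 0 < r) :
    ∫ x, g x = r * ∫ y, g (r * y) := by
  rw [Measure.integral_comp_mul_left, abs_of_pos (inv_pos.2 hr), smul_eq_mul,
    mul_inv_cancel_left₀ hr.ne']

end Dilation

lemma integral_deriv_dilation_mul_barenblattProfile {d k q : ℝ} (hd : 0 < d) (hk : 0 < k)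
    {ψ : ℝ → ℝ} (hψ : ContDiff ℝ 1 ψ) (hs : HasCompactSupport ψ) {r : ℝ} (hr : 0 < r) :
    2 * k * q * ∫ y, ψ (r * y) * y * barenblattProfile d k (q + 1) y
      = r * ∫ y, deriv ψ (r * y) * barenblattProfile d k q y := by
  have hψ' : Continuous (deriv ψ) := hψ.continuous_deriv le_rfl
  have hc := continuous_barenblattProfile (p := q) hd hk
  have hc1 := continuous_barenblattProfile (p := q + 1) hd hk
  have hψc := hψ.continuous
  have hs1 : HasCompactSupport fun y => ψ (r * y) := by
    simpa [Function.comp_def] using hs.comp_homeomorph (Homeomorph.mulLeft₀ r hr.ne')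
  have hs2 : HasCompactSupport fun y => deriv ψ (r * y) * r := by
    have := hs.deriv.comp_homeomorph (Homeomorph.mulLeft₀ r hr.ne')
    exact this.mul_right (f' := fun _ => r)
  have h := integral_mul_deriv_eq_deriv_mul_of_integrable
    (u := fun y => ψ (r * y)) (u' := fun y => deriv ψ (r * y) * r)
    (v := barenblattProfile d k q)
    (v' := fun y => -(2 * k * q) * (y * barenblattProfile d k (q + 1) y))
    (fun y _ => by
      have h := ((hψ.differentiable one_ne_zero (r * y)).hasDerivAt).comp y
        ((hasDerivAt_id y).const_mul r)
      simpa [Function.comp_def] using h)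
    (fun y _ => hasDerivAt_barenblattProfile hd hk y)
    (Continuous.integrable_of_hasCompactSupport (by fun_prop) hs1.mul_right)
    (Continuous.integrable_of_hasCompactSupport (by fun_prop) hs2.mul_right)
    (Continuous.integrable_of_hasCompactSupport (by fun_prop) hs1.mul_right)
  have h1 : ∫ y, ψ (r * y) * (-(2 * k * q) * (y * barenblattProfile d k (q + 1) y))
      = -(2 * k * q * ∫ y, ψ (r * y) * y * barenblattProfile d k (q + 1) y) := by
    rw [← integral_const_mul, ← integral_neg]
    congr 1 with y
    ring
  have h2 : ∫ y, deriv ψ (r * y) * r * barenblattProfile d k q y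
      = r * ∫ y, deriv ψ (r * y) * barenblattProfile d k q y := by
    rw [← integral_const_mul]
    congr 1 with y
    ring
  rw [h1, h2] at h
  exact neg_injective h

section Barenblatt

variable {m : ℝ}

lemma ktilde_pos (hm : m ∈ Ioo (0 : ℝ) 1) : 0 < ktilde m := by
  obtain ⟨h0, h1⟩ := hm
  have : 0 < 1 - m := by linarith
  unfold ktilde
  positivity

lemma Iconst_pos (hm : m ∈ Ioo (0 : ℝ) 1) : 0 < Iconst m := by
  obtain ⟨h0, h1⟩ := hm
  have h : 0 ≤ 2 * m / (1 - m) := div_nonneg (by linarith) (by linarith)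
  refine intervalIntegral.intervalIntegral_pos_of_pos_on ?_ (fun x hx => ?_)
    (by linarith [pi_pos])
  · exact (continuous_cos.rpow_const fun _ => Or.inr h).intervalIntegrable _ _
  · exact rpow_pos_of_pos (cos_pos_of_mem_Ioo hx) _

lemma Dconst_pos (hm : m ∈ Ioo (0 : ℝ) 1) : 0 < Dconst m :=
  rpow_pos_of_pos (div_pos (Iconst_pos hm) (sqrt_pos.2 (ktilde_pos hm))) _

/-- The constant `D` normalises the mass of the profile to one. -/
lemma integral_barenblattProfile_eq_one (hm : m ∈ Ioo (0 : ℝ) 1) :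
    ∫ y, barenblattProfile (Dconst m) (ktilde m) (1 / (1 - m)) y = 1 := by
  have hD := Dconst_pos hm
  have hk := ktilde_pos hm
  have hI := Iconst_pos hm
  have h1 : 1 - m ≠ 0 := by linarith [hm.2]
  have h2 : m + 1 ≠ 0 := by linarith [hm.1]
  have hsk := sqrt_pos.2 hk
  rw [integral_barenblattProfile hD hk,
    show 2 * (1 / (1 - m)) - 2 = 2 * m / (1 - m) by field_simp; ring]
  change _ * Iconst m = 1
  have hDI : √(Dconst m) * Dconst m ^ (-(1 / (1 - m))) = (Iconst m / √(ktilde m))⁻¹ := by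
    rw [sqrt_eq_rpow, ← rpow_add hD, Dconst, ← rpow_mul (by positivity), ← rpow_neg_one]
    congr 1
    field_simp
    ring
  rw [sqrt_div hD.le, div_mul_eq_mul_div, hDI]
  field_simp

lemma barenblatt_dilation (m : ℝ) {t : ℝ} (ht : 0 < t) (y : ℝ) :
    barenblatt m t (t ^ (1 / (m + 1)) * y)
      = (t ^ (1 / (m + 1)))⁻¹ * barenblattProfile (Dconst m) (ktilde m) (1 / (1 - m)) y := by
  have hr : 0 < t ^ (1 / (m + 1)) := rpow_pos_of_pos ht _
  have h2 : t ^ (-(2 * (1 / (m + 1)))) = ((t ^ (1 / (m + 1))) ^ 2)⁻¹ := by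
    rw [rpow_neg ht.le, mul_comm, rpow_mul ht.le, rpow_two]
  rw [barenblatt, barenblattProfile, h2, rpow_neg ht.le]
  congr 3
  field_simp

lemma integral_mul_barenblatt (m : ℝ) (φ : ℝ → ℝ) {t : ℝ} (ht : 0 < t) :
    ∫ x, φ x * barenblatt m t x
      = ∫ y, φ (t ^ (1 / (m + 1)) * y)
          * barenblattProfile (Dconst m) (ktilde m) (1 / (1 - m)) y := by
  have hr : 0 < t ^ (1 / (m + 1)) := rpow_pos_of_pos ht _
  rw [integral_eq_mul_integral_dilation _ hr, ← integral_const_mul]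
  congr 1 with y
  rw [barenblatt_dilation m ht]
  field_simp

lemma integral_barenblatt_rpow_mul (hm : m ∈ Ioo (0 : ℝ) 1) (χ : ℝ → ℝ) {t : ℝ} (ht : 0 < t) :
    ∫ x, barenblatt m t x ^ m * χ x
      = t ^ ((1 - m) / (m + 1)) * ∫ y, χ (t ^ (1 / (m + 1)) * y)
          * barenblattProfile (Dconst m) (ktilde m) (m / (1 - m)) y := by
  have hr : 0 < t ^ (1 / (m + 1)) := rpow_pos_of_pos ht _
  rw [integral_eq_mul_integral_dilation _ hr, ← integral_const_mul, ← integral_const_mul]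
  congr 1 with y
  have hD := Dconst_pos hm
  have hk := ktilde_pos hm
  have hb := barenblattProfile_base_pos hD hk y
  have hF := barenblattProfile_pos (p := 1 / (1 - m)) hD hk y
  have hFm : barenblattProfile (Dconst m) (ktilde m) (1 / (1 - m)) y ^ m
      = barenblattProfile (Dconst m) (ktilde m) (m / (1 - m)) y := by
    rw [barenblattProfile, barenblattProfile, ← rpow_mul hb.le]
    congr 1
    ring
  have hpow : t ^ (1 / (m + 1)) * ((t ^ (1 / (m + 1)))⁻¹) ^ m = t ^ ((1 - m) / (m + 1)) := by
    rw [← rpow_neg ht.le, ← rpow_mul ht.le, ← rpow_add ht]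
    congr 1
    ring
  rw [barenblatt_dilation m ht, mul_rpow (by positivity) hF.le, hFm, ← hpow]
  ring

lemma measurable_barenblatt (m : ℝ) : Measurable fun z : ℝ × ℝ => barenblatt m z.1 z.2 := by
  unfold barenblatt
  fun_prop

lemma barenblatt_rpow_mem_Icc (hm : m ∈ Ioo (0 : ℝ) 1) {t : ℝ} (ht : 0 < t) (x : ℝ) :
    barenblatt m t x ^ m
      ∈ Icc 0 (t ^ (-(m / (m + 1))) * (Dconst m ^ (-(1 / (1 - m)))) ^ m) := by
  have hr : 0 < t ^ (1 / (m + 1)) := rpow_pos_of_pos ht _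
  have hD := Dconst_pos hm
  have hk := ktilde_pos hm
  obtain ⟨y, rfl⟩ : ∃ y, t ^ (1 / (m + 1)) * y = x := ⟨x / t ^ (1 / (m + 1)), by field_simp⟩
  have hF := barenblattProfile_pos (p := 1 / (1 - m)) hD hk y
  have hpow : ((t ^ (1 / (m + 1)))⁻¹) ^ m = t ^ (-(m / (m + 1))) := by
    rw [← rpow_neg ht.le, ← rpow_mul ht.le]
    congr 1
    ring
  rw [barenblatt_dilation m ht, mul_rpow (by positivity) hF.le, hpow]
  refine ⟨by positivity, mul_le_mul_of_nonneg_left ?_ (by positivity)⟩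
  exact rpow_le_rpow hF.le (barenblattProfile_le hD hk
    (one_div_nonneg.2 (by linarith [hm.2])) y) hm.1.le

lemma intervalIntegrable_integral_barenblatt_rpow_mul (hm : m ∈ Ioo (0 : ℝ) 1) {χ : ℝ → ℝ}
    (hχ : Measurable χ) (hχi : Integrable χ) {t : ℝ} (ht : 0 < t) :
    IntervalIntegrable (fun s => ∫ x, barenblatt m s x ^ m * χ x) volume 0 t := by
  have hm1 : 0 < m + 1 := by linarith [hm.1]
  have hexp : -1 < -(m / (m + 1)) := by
    rw [neg_lt_neg_iff, div_lt_one hm1]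
    linarith
  refine (((intervalIntegral.intervalIntegrable_rpow' hexp).mul_const
    ((Dconst m ^ (-(1 / (1 - m)))) ^ m)).mul_const (∫ x, ‖χ x‖)).mono_fun' ?_ ?_
  · have hmeas : Measurable fun z : ℝ × ℝ => barenblatt m z.1 z.2 ^ m * χ z.2 :=
      ((measurable_barenblatt m).pow_const m).mul (hχ.comp measurable_snd)
    exact hmeas.stronglyMeasurable.integral_prod_right.aestronglyMeasurable
  · refine (ae_restrict_mem measurableSet_uIoc).mono fun s hs => ?_
    rw [uIoc_of_le ht.le] at hs
    dsimp only
    rw [← integral_const_mul]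
    refine norm_integral_le_of_norm_le (hχi.norm.const_mul _) (.of_forall fun x => ?_)
    obtain ⟨h0, h1⟩ := barenblatt_rpow_mem_Icc hm hs.1 x
    rw [norm_mul, norm_of_nonneg h0]
    exact mul_le_mul_of_nonneg_right h1 (norm_nonneg _)

/-- The weak form of the fast diffusion equation, differentiated in time. -/
lemma hasDerivAt_integral_dilation_mul_barenblattProfile (hm : m ∈ Ioo (0 : ℝ) 1) {φ : ℝ → ℝ}
    (hφ : ContDiff ℝ 2 φ) (hs : HasCompactSupport φ) {t : ℝ} (ht : 0 < t) :
    HasDerivAt (fun t : ℝ => ∫ y, φ (t ^ (1 / (m + 1)) * y)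
        * barenblattProfile (Dconst m) (ktilde m) (1 / (1 - m)) y)
      (∫ x, barenblatt m t x ^ m * deriv (deriv φ) x) t := by
  have hm0 := hm.1
  have h1m : 0 < 1 - m := by linarith [hm.2]
  have hr : 0 < t ^ (1 / (m + 1)) := rpow_pos_of_pos ht _
  have hD := Dconst_pos hm
  have hk := ktilde_pos hm
  have hp : 1 ≤ 1 / (1 - m) := by
    rw [le_div_iff₀ h1m]
    linarith
  have hφ' : ContDiff ℝ 1 (deriv φ) :=
    (contDiff_succ_iff_deriv.1 (show ContDiff ℝ (1 + 1) φ from hφ)).2.2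
  have hH := (hasDerivAt_integral_dilation_mul (hφ.of_le one_le_two) hs
    (integrable_barenblattProfile hD hk hp) hr).comp t
    (hasDerivAt_rpow_const (p := 1 / (m + 1)) (Or.inl ht.ne'))
  refine hH.congr_deriv ?_
  have hparts := integral_deriv_dilation_mul_barenblattProfile (q := m / (1 - m)) hD hk hφ'
    hs.deriv hr
  have hq : m / (1 - m) + 1 = 1 / (1 - m) := by
    field_simp
    ring
  have hα : 2 * ktilde m * (m / (1 - m)) = 1 / (m + 1) := by
    unfold ktilde
    field_simp
  have hpow : t ^ ((1 - m) / (m + 1)) = t ^ (1 / (m + 1)) * t ^ (1 / (m + 1) - 1) := by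
    rw [← rpow_add ht]
    congr 1
    field_simp
    ring
  rw [hq, hα] at hparts
  rw [integral_barenblatt_rpow_mul hm _ ht, hpow, mul_right_comm, ← hparts]
  ring

end Barenblatt

/-- the Barenblatt function is a solution in the sense of distributions of
∂_t u = ∂²_{xx}(u^m) with initial condition the Dirac measure δ₀. -/
theorem barenblatt_distributional_solution
    (m : ℝ) (hm : m ∈ Set.Ioo (0:ℝ) 1)
    (φ : ℝ → ℝ) (hφ : ContDiff ℝ (⊤ : ℕ∞) φ) (hφsupp : HasCompactSupport φ)
    (t : ℝ) (ht : 0 < t) :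
    ∫ x, φ x * barenblatt m t x
      = φ 0 + ∫ s in (0:ℝ)..t, ∫ x, barenblatt m s x ^ m * deriv (deriv φ) x := by
  have hm0 := hm.1
  have h1m : 0 < 1 - m := by linarith [hm.2]
  have hα : 0 < 1 / (m + 1) := by positivity
  have hp : 1 ≤ 1 / (1 - m) := by
    rw [le_div_iff₀ h1m]
    linarith
  have hφ2 : ContDiff ℝ 2 φ := contDiff_infty.1 hφ 2
  have hφ'' : Continuous (deriv (deriv φ)) :=
    (contDiff_succ_iff_deriv.1 (show ContDiff ℝ (1 + 1) φ from hφ2)).2.2.continuous_deriv le_rfl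
  have hcont : Continuous fun t : ℝ => ∫ y, φ (t ^ (1 / (m + 1)) * y)
      * barenblattProfile (Dconst m) (ktilde m) (1 / (1 - m)) y :=
    (continuous_integral_dilation_mul hφ.continuous hφsupp
      (integrable_barenblattProfile (Dconst_pos hm) (ktilde_pos hm) hp)).comp
      (continuous_rpow_const hα.le)
  rw [intervalIntegral.integral_eq_sub_of_hasDerivAt_of_le ht.le hcont.continuousOn
    (fun s hs => hasDerivAt_integral_dilation_mul_barenblattProfile hm hφ2 hφsupp hs.1)
    (intervalIntegrable_integral_barenblatt_rpow_mul hm hφ''.measurable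
      (hφ''.integrable_of_hasCompactSupport hφsupp.deriv.deriv) ht),
    integral_mul_barenblatt m φ ht]
  simp only [zero_rpow hα.ne', zero_mul, integral_const_mul, integral_barenblattProfile_eq_one hm]
  ring
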